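/- Let H be a finite group acting transitively on a finite set X with |X| = n ≥ 2, and let s₁,…,s_d be chosen independently and uniformly at random from H. Form the bipartite Schreier graph on two disjoint copies of X, where each x in the left copy is joined to sᵢ·x in the right copy for i = 1,…,d, and let M be its normalized adjacency matrix (the 2n×2n symmetric matrix of the graph with entries divided by d). Its eigenvalues are real and symmetric about 0, and the two largest in absolute value are 1 and −1; let μ be the largest absolute value among the remaining eigenvalues. Then E(|μ|) ≤ e·√((ln n)/d). -/

import Mathlib

open scoped BigOperators

namespace RandomSchreier

open scoped Nat
open Finset

section Words

lemma sum_sum_update {H ι : Type*} [Fintype H] [Fintype ι] [DecidableEq ι] (F : (ι → H) → ℝ) (a : ι) :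
    ∑ s : ι → H, ∑ x : H, F (Function.update s a x) = Fintype.card H * ∑ s, F s := by
  have key : Function.Involutive
      fun p : (ι → H) × H => (Function.update p.1 a p.2, p.1 a) := by
    rintro ⟨s, x⟩
    simp
  rw [← Fintype.sum_prod_type' (f := fun s x => F (Function.update s a x)),
    key.bijective.sum_comp (fun p : (ι → H) × H => F p.1), Fintype.sum_prod_type]
  simp [mul_sum]

variable {H X ι : Type*} [Group H]

/-- The letter `s i` or its inverse, according to the sign `b`. -/
def letter (s : ι → H) (b : Bool) (i : ι) : H := if b then (s i)⁻¹ else s i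

/-- The group element spelled by the word `w` with signs `ε` in the generators `s`. -/
def wordEval {m : ℕ} (s : ι → H) (ε : Fin m → Bool) (w : Fin m → ι) : H :=
  (List.ofFn fun j => letter s (ε j) (w j)).prod

/-- Some letter occurs exactly once in `w`. -/
def HasSingleton {m : ℕ} (w : Fin m → ι) : Prop := ∃ j₀, ∀ j, w j = w j₀ → j = j₀

lemma wordEval_succ {m : ℕ} (s : ι → H) (ε : Fin (m + 1) → Bool) (w : Fin (m + 1) → ι) :
    wordEval s ε w =
      letter s (ε 0) (w 0) * wordEval s (fun j => ε j.succ) (fun j => w j.succ) := by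
  simp [wordEval, List.ofFn_succ]

lemma letter_update_of_ne [DecidableEq ι] (s : ι → H) (b : Bool) {a i : ι} (h : i ≠ a) (x : H) :
    letter (Function.update s a x) b i = letter s b i := by
  simp [letter, Function.update_of_ne h]

lemma wordEval_update_of_forall_ne [DecidableEq ι] {m : ℕ} (s : ι → H) (ε : Fin m → Bool)
    (w : Fin m → ι) {a : ι} (h : ∀ j, w j ≠ a) (x : H) :
    wordEval (Function.update s a x) ε w = wordEval s ε w := by
  simp only [wordEval, letter_update_of_ne s _ (h _) x]

lemma bijective_letter_update [DecidableEq ι] (s : ι → H) (b : Bool) (a : ι) :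
    Function.Bijective fun x => letter (Function.update s a x) b a := by
  cases b
  · simp [letter, Function.bijective_iff_existsUnique]
  · simpa [letter] using (Equiv.inv H).bijective

lemma bijective_wordEval_update [DecidableEq ι] {m : ℕ} (s : ι → H) (ε : Fin m → Bool)
    (w : Fin m → ι) (j₀ : Fin m) (h : ∀ j, w j = w j₀ → j = j₀) :
    Function.Bijective fun x => wordEval (Function.update s (w j₀) x) ε w := by
  induction m with
  | zero => exact j₀.elim0
  | succ m ih =>
    simp only [wordEval_succ]
    cases j₀ using Fin.cases with
    | zero =>
      have hne : ∀ j : Fin m, w j.succ ≠ w 0 := fun j hj => Fin.succ_ne_zero j (h _ hj)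
      simp only [wordEval_update_of_forall_ne s _ _ hne]
      exact (Group.mulRight_bijective _).comp (bijective_letter_update s _ _)
    | succ j₀ =>
      have hne : w 0 ≠ w j₀.succ := fun hj => (Fin.succ_ne_zero j₀).symm (h _ hj)
      simp only [letter_update_of_ne s _ hne]
      exact (Group.mulLeft_bijective _).comp
        (ih (fun j => ε j.succ) (fun j => w j.succ) j₀
          fun j hj => Fin.succ_injective _ (h _ hj))

/-- The permutation matrix of `g`. -/
def permMat (X : Type*) [MulAction H X] [DecidableEq X] (g : H) : Matrix X X ℝ :=
  Matrix.of fun x y => if x = g • y then 1 else 0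

lemma permMat_one [MulAction H X] [DecidableEq X] : permMat X (1 : H) = 1 := by
  ext x y
  simp [permMat, Matrix.one_apply]

variable [MulAction H X] [Fintype X] [DecidableEq X]

/-- The number of fixed points of `g`. -/
noncomputable def fix (X : Type*) [MulAction H X] [Fintype X] [DecidableEq X] (g : H) : ℝ :=
  (#{x : X | x = g • x} : ℝ)

lemma fix_le_card (g : H) : fix X g ≤ Fintype.card X := by
  unfold fix
  exact_mod_cast card_le_univ _

lemma sum_fix [Fintype H] [Nonempty X] [MulAction.IsPretransitive H X] :
    ∑ g : H, fix X g = Fintype.card H := by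
  classical
  have h := MulAction.sum_card_fixedBy_eq_card_orbits_mul_card_group H X
  have h1 : Fintype.card (Quotient (MulAction.orbitRel H X)) = 1 := by
    rw [Fintype.card_eq_one_iff_nonempty_unique]
    have := (MulAction.pretransitive_iff_subsingleton_quotient H X).1 inferInstance
    obtain ⟨x⟩ := ‹Nonempty X›
    exact ⟨⟨⟨Quotient.mk _ x⟩, fun _ => Subsingleton.elim _ _⟩⟩
  rw [h1, one_mul] at h
  rw [← h, Nat.cast_sum]
  refine sum_congr rfl fun g _ => ?_
  rw [fix, Fintype.card_subtype]
  simp only [MulAction.mem_fixedBy, eq_comm]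

lemma sum_fix_wordEval [Fintype H] [Nonempty X] [MulAction.IsPretransitive H X]
    [Fintype ι] [DecidableEq ι] {m : ℕ} (ε : Fin m → Bool) (w : Fin m → ι) (hw : HasSingleton w) :
    ∑ s : ι → H, fix X (wordEval s ε w) = (Fintype.card H : ℝ) ^ Fintype.card ι := by
  obtain ⟨j₀, hj₀⟩ := hw
  have h := sum_sum_update (fun s : ι → H => fix X (wordEval s ε w)) (w j₀)
  have h2 : ∀ s : ι → H,
      ∑ x : H, fix X (wordEval (Function.update s (w j₀) x) ε w) = Fintype.card H := by
    intro s
    rw [← sum_fix (H := H) (X := X)]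
    exact (bijective_wordEval_update s ε w j₀ hj₀).sum_comp (fix X)
  simp only [h2, sum_const, card_univ, Fintype.card_fun, nsmul_eq_mul, Nat.cast_pow] at h
  have hH : (Fintype.card H : ℝ) ≠ 0 := by exact_mod_cast Fintype.card_ne_zero
  rw [mul_comm] at h
  exact (mul_left_cancel₀ hH h).symm

lemma card_not_hasSingleton_le [Fintype ι] [DecidableEq ι] {k : ℕ} (hk : k ≤ Fintype.card ι)
    [DecidablePred (HasSingleton : (Fin (2 * k) → ι) → Prop)] :
    #{w : Fin (2 * k) → ι | ¬ HasSingleton w} ≤ (Fintype.card ι).choose k * k ^ (2 * k) := by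
  have hsub : ({w : Fin (2 * k) → ι | ¬ HasSingleton w} : Finset _) ⊆
      (powersetCard k univ).biUnion fun S : Finset ι => Fintype.piFinset fun _ => S := by
    intro w hw
    simp only [HasSingleton, mem_filter, mem_univ, true_and, not_exists, not_forall] at hw
    have himg : 2 * #(univ.image w) ≤ #(univ : Finset (Fin (2 * k))) := by
      refine mul_card_image_le_card _ 2 fun a ha => ?_
      obtain ⟨j₀, -, rfl⟩ := mem_image.1 ha
      obtain ⟨j, hj, hne⟩ := hw j₀
      exact one_lt_card.2 ⟨j, by simp [hj], j₀, by simp, hne⟩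
    obtain ⟨S, hS, hcard⟩ := exists_superset_card_eq (n := k)
      (s := univ.image w) (by simpa using himg) hk
    simp only [mem_biUnion, mem_powersetCard, Fintype.mem_piFinset]
    exact ⟨S, ⟨subset_univ _, hcard⟩, fun j => hS (mem_image_of_mem _ (mem_univ _))⟩
  refine (card_le_card hsub).trans ((card_biUnion_le_card_mul _ _ (k ^ (2 * k)) ?_).trans ?_)
  · intro S hS
    simp [Fintype.card_piFinset, (mem_powersetCard.1 hS).2]
  · simp [card_powersetCard]

lemma permMat_mul (g h : H) : permMat X (g * h) = permMat X g * permMat X h := by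
  ext x z
  simp only [permMat, Matrix.mul_apply, Matrix.of_apply, mul_smul]
  rw [sum_eq_single (h • z) (fun y _ hy => by simp [hy]) (by simp)]
  simp

lemma trace_permMat (g : H) : (permMat X g).trace = fix X g := by
  simp [permMat, Matrix.trace, fix]

lemma permMat_list_prod (l : List H) : permMat X l.prod = (l.map (permMat X)).prod := by
  induction l with
  | nil => simp [permMat_one]
  | cons a l ih => simp [permMat_mul, ih]

lemma prod_ofFn_of_periodic_two {R : Type*} [Monoid R] (u : ℕ → R) (hu : ∀ j, u (j + 2) = u j)
    (k : ℕ) : (List.ofFn fun j : Fin (2 * k) => u j).prod = (u 0 * u 1) ^ k := by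
  induction k with
  | zero => simp
  | succ k ih =>
    change (List.ofFn fun j : Fin (2 * k + 1 + 1) => u j).prod = _
    simp [List.ofFn_succ, hu, ih, pow_succ', mul_assoc]

/-- Alternating signs. -/
def altSign (j : ℕ) : Bool := decide (j % 2 = 0)

lemma altSign_add_two (j : ℕ) : altSign (j + 2) = altSign j := by simp [altSign]

lemma trace_pow_eq_sum_fix [Fintype ι] [DecidableEq ι] (A : Matrix X X ℝ) (s : ι → H)
    (hA : ∀ x y, A x y = (#{i : ι | s i • x = y} : ℝ)) (k : ℕ) :
    ((A * A.transpose) ^ k).trace =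
      ∑ w : Fin (2 * k) → ι, fix X (wordEval s (fun j => altSign j) w) := by
  have h0 : A = ∑ i, permMat X (letter s (altSign 0) i) := by
    ext x y
    simp [hA, permMat, letter, altSign, Matrix.sum_apply, eq_inv_smul_iff]
  have h1 : A.transpose = ∑ i, permMat X (letter s (altSign 1) i) := by
    ext x y
    simp [hA, permMat, letter, altSign, Matrix.sum_apply, eq_comm]
  have hprod := prod_ofFn_of_periodic_two
    (fun j => ∑ i, permMat X (letter s (altSign j) i)) (by simp [altSign_add_two]) k
  simp only [← h0, ← h1] at hprod
  rw [← hprod, ← MultilinearMap.mkPiAlgebraFin_apply (R := ℝ), MultilinearMap.map_sum,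
    Matrix.trace_sum]
  refine sum_congr rfl fun w _ => ?_
  rw [MultilinearMap.mkPiAlgebraFin_apply, ← trace_permMat, wordEval, permMat_list_prod,
    List.map_ofFn]
  rfl

lemma sum_trace_pow_le [Fintype H] [Nonempty X] [MulAction.IsPretransitive H X] {d : ℕ}
    (A : (Fin d → H) → Matrix X X ℝ)
    (hA : ∀ s x y, A s x y = (#{i : Fin d | s i • x = y} : ℝ)) {k : ℕ} (hk : k ≤ d) :
    ∑ s, ((A s * (A s).transpose) ^ k).trace ≤ (Fintype.card H : ℝ) ^ d *
      ((d : ℝ) ^ (2 * k) + Fintype.card X * ((d.choose k : ℝ) * (k : ℝ) ^ (2 * k))) := by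
  classical
  have hcount := card_not_hasSingleton_le (ι := Fin d) (k := k) (by simpa using hk)
  rw [Fintype.card_fin] at hcount
  have hword : ∀ w : Fin (2 * k) → Fin d,
      ∑ s : Fin d → H, fix X (wordEval s (fun j => altSign j) w) ≤
        (Fintype.card H : ℝ) ^ d *
          (1 + if ¬ HasSingleton w then (Fintype.card X : ℝ) else 0) := by
    intro w
    by_cases hw : HasSingleton w
    · simpa [hw] using (sum_fix_wordEval (H := H) (X := X) (fun j => altSign j) w hw).le
    · calc _ ≤ ∑ s : Fin d → H, (Fintype.card X : ℝ) := sum_le_sum fun s _ => fix_le_card _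
        _ = (Fintype.card H : ℝ) ^ d * Fintype.card X := by simp
        _ ≤ _ := by
          gcongr
          simp [hw]
  simp only [fun s => trace_pow_eq_sum_fix (A s) s (hA s) k]
  rw [sum_comm]
  refine (sum_le_sum fun w _ => hword w).trans ?_
  rw [← mul_sum, sum_add_distrib, ← sum_filter]
  simp only [sum_const, card_univ, Fintype.card_fun, Fintype.card_fin, nsmul_eq_mul, mul_one]
  rw [mul_comm _ (Fintype.card X : ℝ)]
  push_cast
  gcongr
  exact_mod_cast hcount

end Words

section Spectral

lemma trace_pow_eq_sum_eigenvalues_pow {Y : Type*} [Fintype Y] [DecidableEq Y]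
    {M : Matrix Y Y ℝ} (hM : M.IsHermitian) (j : ℕ) :
    (M ^ j).trace = ∑ i, hM.eigenvalues i ^ j := by
  conv_lhs => rw [hM.spectral_theorem]
  rw [← map_pow, Matrix.diagonal_pow, Unitary.conjStarAlgAut_apply, Matrix.trace_mul_cycle]
  simp [Matrix.trace_diagonal]

lemma trace_fromBlocks_eq_add {X : Type*} [Fintype X] (A B C D : Matrix X X ℝ) :
    (Matrix.fromBlocks A B C D).trace = A.trace + D.trace := by
  simp [Matrix.trace]

variable {X : Type*} [Fintype X] [DecidableEq X]

lemma fromBlocks_offDiag_pow_two_mul (A : Matrix X X ℝ) (k : ℕ) :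
    (Matrix.fromBlocks 0 A A.transpose 0) ^ (2 * k) =
      Matrix.fromBlocks ((A * A.transpose) ^ k) 0 0 ((A.transpose * A) ^ k) := by
  rw [pow_mul, pow_two, Matrix.fromBlocks_multiply]
  simp [Matrix.fromBlocks_diagonal_pow]

lemma trace_mul_pow_comm (A B : Matrix X X ℝ) (k : ℕ) :
    ((A * B) ^ k).trace = ((B * A) ^ k).trace := by
  cases k with
  | zero => simp
  | succ k => rw [pow_succ, ← mul_assoc, mul_pow_mul, mul_assoc, Matrix.trace_mul_comm, pow_succ,
      mul_assoc]

lemma trace_fromBlocks_offDiag_pow_even (A : Matrix X X ℝ) (k : ℕ) :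
    ((Matrix.fromBlocks 0 A A.transpose 0) ^ (2 * k)).trace =
      2 * ((A * A.transpose) ^ k).trace := by
  rw [fromBlocks_offDiag_pow_two_mul, trace_fromBlocks_eq_add, trace_mul_pow_comm A.transpose,
    two_mul]

lemma trace_fromBlocks_offDiag_pow_odd (A : Matrix X X ℝ) (k : ℕ) :
    ((Matrix.fromBlocks 0 A A.transpose 0) ^ (2 * k + 1)).trace = 0 := by
  rw [pow_succ, fromBlocks_offDiag_pow_two_mul, Matrix.fromBlocks_multiply]
  simp [trace_fromBlocks_eq_add]

/-- If an odd power sum vanishes, the entry `a` of largest absolute value is counted twice by the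
preceding even power sum. -/
lemma two_mul_abs_pow_le_sum {α : Type*} [DecidableEq α] (S : Finset α) (f : α → ℝ) {a : α}
    (ha : a ∈ S) (hmax : ∀ i ∈ S, |f i| ≤ |f a|) {k : ℕ} (hk : k ≠ 0)
    (hodd : ∑ i ∈ S, f i ^ (2 * k + 1) = 0) :
    2 * |f a| ^ (2 * k) ≤ ∑ i ∈ S, f i ^ (2 * k) := by
  have hev : ∀ x : ℝ, x ^ (2 * k) = |x| ^ (2 * k) := fun x => by
    rw [pow_mul, pow_mul, sq_abs]
  rw [← add_sum_erase S _ ha] at hodd ⊢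
  rw [hev (f a), two_mul]
  gcongr
  rcases (abs_nonneg (f a)).eq_or_lt with h0 | h0
  · rw [← h0, zero_pow (by omega)]
    exact sum_nonneg fun i _ => by rw [hev]; positivity
  · refine le_of_mul_le_mul_right ?_ h0
    calc |f a| ^ (2 * k) * |f a| = |∑ i ∈ S.erase a, f i ^ (2 * k + 1)| := by
          rw [← pow_succ, ← abs_pow, eq_neg_of_add_eq_zero_left hodd, abs_neg]
      _ ≤ ∑ i ∈ S.erase a, |f i ^ (2 * k + 1)| := abs_sum_le_sum_abs _ _
      _ ≤ ∑ i ∈ S.erase a, f i ^ (2 * k) * |f a| := by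
          refine sum_le_sum fun i hi => ?_
          rw [abs_pow, pow_succ, hev (f i)]
          exact mul_le_mul_of_nonneg_left (hmax i (mem_of_mem_erase hi)) (by positivity)
      _ = _ := by rw [sum_mul]

end Spectral

section Numeric

lemma log_factorial_ge {k : ℕ} (hk : 1 ≤ k) : k * Real.log k - k + 1 ≤ Real.log k ! := by
  induction k, hk using Nat.le_induction with
  | base => simp
  | succ k hk ih =>
    have hk0 : (0 : ℝ) < k := by exact_mod_cast hk
    rw [Nat.factorial_succ, Nat.cast_mul, Real.log_mul (by positivity) (by positivity)]
    have h := Real.log_le_sub_one_of_pos (show (0 : ℝ) < (k + 1) / k by positivity)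
    rw [Real.log_div (by positivity) (by positivity)] at h
    have h2 := mul_le_mul_of_nonneg_left h hk0.le
    have h3 : (k : ℝ) * ((k + 1) / k - 1) = 1 := by field_simp; ring
    push_cast
    nlinarith

lemma sq_ceil_sub_le {L : ℝ} (hL : 1 / 2 ≤ L) : ((⌈L⌉₊ : ℝ) - L) ^ 2 ≤ L := by
  have h1 := Nat.le_ceil L
  have h2 := Nat.ceil_lt_add_one (show 0 ≤ L by linarith)
  rcases le_or_gt L 1 with h | h
  · have : (⌈L⌉₊ : ℝ) ≤ 1 := by exact_mod_cast Nat.ceil_le.2 (by simpa using h)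
    nlinarith
  · nlinarith

lemma mul_pow_div_factorial_le {n : ℕ} (hn : 2 ≤ n) {k : ℕ} (hk : k = ⌈Real.log n⌉₊) :
    (n : ℝ) * (k : ℝ) ^ (2 * k) / k ! ≤ (Real.exp 1 ^ 2 * Real.log n) ^ k := by
  set L := Real.log n with hLdef
  have hn0 : (0 : ℝ) < n := by positivity
  have hL : 1 / 2 ≤ L := by
    have h2 : Real.log 2 ≤ L := Real.log_le_log (by norm_num) (by exact_mod_cast hn)
    linarith [Real.log_two_gt_d9]
  have hL0 : 0 < L := by linarith
  have hk1 : 1 ≤ k := hk ▸ Nat.ceil_pos.2 hL0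
  have hk0 : (0 : ℝ) < k := by exact_mod_cast hk1
  have hsq : ((k : ℝ) - L) ^ 2 ≤ L := hk ▸ sq_ceil_sub_le hL
  rw [← Real.log_le_log_iff (by positivity) (by positivity), Real.log_div (by positivity)
    (by positivity), Real.log_mul (by positivity) (by positivity), Real.log_pow, Real.log_pow,
    Real.log_mul (by positivity) (by positivity), Real.log_pow, Real.log_exp, ← hLdef]
  have hf := log_factorial_ge hk1
  have h := Real.log_le_sub_one_of_pos (show (0 : ℝ) < k / L by positivity)
  rw [Real.log_div (by positivity) (by positivity)] at h
  have h2 := mul_le_mul_of_nonneg_left h hk0.le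
  have h3 : (k : ℝ) * (k / L - 1) ≤ k - L + 1 := by
    have : (k : ℝ) * (k / L - 1) - (k - L) = (k - L) ^ 2 / L := by field_simp
    have : (k - L) ^ 2 / L ≤ 1 := (div_le_one hL0).2 hsq
    linarith
  push_cast
  nlinarith

end Numeric

end RandomSchreier

open RandomSchreier

/-- Let `H` be a finite group acting transitively on a finite set `X`
with `|X| = n ≥ 2`, and let `s₁, …, s_d` be independent uniform random elements of `H`.
Form the bipartite Schreier graph on two disjoint copies of `X` (each `x` on the left is
joined to `sᵢ • x` on the right), with normalized adjacency matrix
`M s = (1/d) • [[0, A],[Aᵀ, 0]]` where `A x y = #{i : sᵢ • x = y}`.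
Its eigenvalues, listed with multiplicity and ordered by decreasing absolute value,
start with `1` and `-1` (in some order); let `μ s 2` be the next one.
Then `E(|μ|) ≤ e·√((ln n)/d)`. -/
theorem stmt1
    {H X : Type*} [Group H] [Fintype H] [Fintype X] [DecidableEq X]
    [MulAction H X] (htrans : MulAction.IsPretransitive H X)
    {n : ℕ} (hn : Fintype.card X = n) (hn2 : 2 ≤ n)
    {d : ℕ} (hd : 0 < d)
    (A : (Fin d → H) → Matrix X X ℝ)
    (hA : ∀ s x y, A s x y = ((Finset.univ.filter fun i : Fin d => s i • x = y).card : ℝ))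
    (M : (Fin d → H) → Matrix (X ⊕ X) (X ⊕ X) ℝ)
    (hM : ∀ s, M s = (d : ℝ)⁻¹ • Matrix.fromBlocks 0 (A s) (A s).transpose 0)
    (μ : (Fin d → H) → Fin (2 * n) → ℝ)
    (hμ : ∀ s : Fin d → H, ∃ hsym : (M s).IsHermitian, ∃ e : Fin (2 * n) ≃ (X ⊕ X),
      (∀ i, μ s i = hsym.eigenvalues (e i)) ∧
      (∀ i j : Fin (2 * n), i ≤ j → |μ s j| ≤ |μ s i|) ∧
      ((μ s ⟨0, by omega⟩ = 1 ∧ μ s ⟨1, by omega⟩ = -1) ∨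
        (μ s ⟨0, by omega⟩ = -1 ∧ μ s ⟨1, by omega⟩ = 1))) :
    (∑ s : Fin d → H, |μ s ⟨2, by omega⟩|) / (Fintype.card H : ℝ) ^ d
      ≤ Real.exp 1 * Real.sqrt (Real.log n / d) := by
  have hne : Nonempty X := Fintype.card_pos_iff.1 (by omega)
  have hd0 : (0 : ℝ) < d := by exact_mod_cast hd
  have hH : (0 : ℝ) < Fintype.card H := by exact_mod_cast Fintype.card_pos
  have hL : 0 < Real.log n := Real.log_pos (by exact_mod_cast hn2)
  have hcard : ∑ _s : Fin d → H, (1 : ℝ) = (Fintype.card H : ℝ) ^ d := by simp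
  obtain ⟨k, hk⟩ : ∃ k, k = ⌈Real.log n⌉₊ := ⟨_, rfl⟩
  have hk0 : 0 < k := hk ▸ Nat.ceil_pos.2 hL
  have hB : (Real.exp 1 * Real.sqrt (Real.log n / d)) ^ 2 =
      Real.exp 1 ^ 2 * Real.log n / d := by
    rw [mul_pow, Real.sq_sqrt (by positivity), mul_div_assoc]
  rcases lt_or_ge d k with hdk | hkd
  · have h1 : ∀ s, |μ s ⟨2, by omega⟩| ≤ 1 := by
      intro s
      obtain ⟨-, -, -, hanti, h01⟩ := hμ s
      refine (hanti ⟨0, by omega⟩ _ (Fin.mk_le_mk.2 (by omega))).trans ?_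
      rcases h01 with ⟨h, -⟩ | ⟨h, -⟩ <;> simp [h]
    have hdL : (d : ℝ) < Real.log n := Nat.lt_ceil.1 (hk ▸ hdk)
    have hone : 1 ≤ Real.exp 1 * Real.sqrt (Real.log n / d) := by
      have h2 : 1 ≤ Real.log n / d := (one_le_div hd0).2 hdL.le
      have h3 : 1 ≤ Real.exp 1 := Real.one_le_exp zero_le_one
      exact one_le_mul_of_one_le_of_one_le h3 (Real.one_le_sqrt.2 h2)
    refine le_trans ?_ hone
    rw [div_le_one (by positivity), ← hcard]
    exact Finset.sum_le_sum fun s _ => h1 s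
  have hpoint : ∀ s, |μ s ⟨2, by omega⟩| ^ (2 * k) ≤
      ((A s * (A s).transpose) ^ k).trace / (d : ℝ) ^ (2 * k) - 1 := by
    intro s
    obtain ⟨hsym, e, he, hanti, h01⟩ := hμ s
    have hsum : ∀ j, ∑ i, μ s i ^ j = (M s ^ j).trace := fun j => by
      rw [trace_pow_eq_sum_eigenvalues_pow hsym, ← e.sum_comp]
      simp only [he]
    set i0 : Fin (2 * n) := ⟨0, by omega⟩
    set i1 : Fin (2 * n) := ⟨1, by omega⟩
    set i2 : Fin (2 * n) := ⟨2, by omega⟩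
    have h10 : i1 ∈ Finset.univ.erase i0 := by simp [i0, i1]
    have hsplit : ∀ j, ∑ i ∈ (Finset.univ.erase i0).erase i1, μ s i ^ j =
        (M s ^ j).trace - (1 + (-1) ^ j) := fun j => by
      rw [← hsum, ← Finset.add_sum_erase _ _ (Finset.mem_univ i0), ← Finset.add_sum_erase _ _ h10]
      rcases h01 with ⟨ha, hb⟩ | ⟨ha, hb⟩ <;> rw [ha, hb] <;> ring
    have hodd : ∑ i ∈ (Finset.univ.erase i0).erase i1, μ s i ^ (2 * k + 1) = 0 := by
      rw [hsplit, hM, smul_pow, Matrix.trace_smul, trace_fromBlocks_offDiag_pow_odd]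
      simp [pow_succ, pow_mul]
    have htwo := two_mul_abs_pow_le_sum ((Finset.univ.erase i0).erase i1) (μ s) (a := i2)
      (by simp [i0, i1, i2]) (fun i hi => hanti i2 i (by
        simp only [Finset.mem_erase, ne_eq, Finset.mem_univ, and_true, i0, i1, Fin.ext_iff] at hi
        exact Fin.mk_le_of_le_val (by omega))) hk0.ne' hodd
    rw [hsplit, hM, smul_pow, Matrix.trace_smul, trace_fromBlocks_offDiag_pow_even,
      pow_mul (-1 : ℝ), neg_one_sq, one_pow, smul_eq_mul, inv_pow] at htwo
    rw [div_eq_inv_mul]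
    linarith
  have hmoment : ∑ s, |μ s ⟨2, by omega⟩| ^ (2 * k) ≤
      (Fintype.card H : ℝ) ^ d * (Real.exp 1 ^ 2 * Real.log n / d) ^ k := by
    calc _ ≤ ∑ s, (((A s * (A s).transpose) ^ k).trace / (d : ℝ) ^ (2 * k) - 1) :=
          Finset.sum_le_sum fun s _ => hpoint s
      _ = (∑ s, ((A s * (A s).transpose) ^ k).trace) / (d : ℝ) ^ (2 * k) -
            (Fintype.card H : ℝ) ^ d := by
          rw [Finset.sum_sub_distrib, hcard, Finset.sum_div]
      _ ≤ (Fintype.card H : ℝ) ^ d * ((d : ℝ) ^ (2 * k) +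
            n * ((d.choose k : ℝ) * (k : ℝ) ^ (2 * k))) / (d : ℝ) ^ (2 * k) -
            (Fintype.card H : ℝ) ^ d := by
          gcongr
          exact hn ▸ sum_trace_pow_le A hA hkd
      _ = (Fintype.card H : ℝ) ^ d *
            (n * ((d.choose k : ℝ) * (k : ℝ) ^ (2 * k)) / (d : ℝ) ^ (2 * k)) := by
          field_simp
          ring
      _ ≤ (Fintype.card H : ℝ) ^ d *
            (n * (((d : ℝ) ^ k / k.factorial) * (k : ℝ) ^ (2 * k)) / (d : ℝ) ^ (2 * k)) := by
          gcongr
          exact Nat.choose_le_pow_div k d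
      _ = (Fintype.card H : ℝ) ^ d * (n * (k : ℝ) ^ (2 * k) / k.factorial / (d : ℝ) ^ k) := by
          rw [mul_comm 2 k, pow_mul (d : ℝ)]
          field_simp
      _ ≤ _ := by
          rw [div_pow _ (d : ℝ)]
          gcongr
          exact mul_pow_div_factorial_le hn2 hk
  refine le_of_pow_le_pow_left₀ (n := 2 * k) (by omega) (by positivity) ?_
  obtain ⟨p, hp⟩ : ∃ p, 2 * k = p + 1 := ⟨2 * k - 1, by omega⟩
  have hjensen := pow_sum_div_card_le_sum_pow (s := Finset.univ)
    (f := fun s => |μ s ⟨2, by omega⟩|) (fun _ _ => abs_nonneg _) p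
  rw [← hp, Finset.card_univ, Fintype.card_fun, Fintype.card_fin, Nat.cast_pow] at hjensen
  rw [pow_mul (Real.exp 1 * _), hB, div_pow, hp, pow_succ ((Fintype.card H : ℝ) ^ d), ← hp,
    ← div_div, div_le_iff₀' (by positivity)]
  exact hjensen.trans hmoment
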